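/- Let G be a finite connected simple graph and let W be a positive weight function on G (W(q) > 0 for every vertex q). Then the weighted cover pebbling number equals the stacking number: Φ_W(G) = SN_W(G), i.e., SN_W(G) is the least natural number m such that every distribution on G with exactly m pebbles in total covers W. -/

import Mathlib

/-- A single pebbling move on graph `G`: remove two pebbles from a vertex `p`
(which must carry at least two pebbles) and add one pebble to an adjacent vertex `q`. -/
def PebblingMove {V : Type*} (G : SimpleGraph V) (D D' : V → ℕ) : Prop :=
  ∃ p q : V, G.Adj p q ∧ 2 ≤ D p ∧
    D' p = D p - 2 ∧ D' q = D q + 1 ∧ ∀ s : V, s ≠ p → s ≠ q → D' s = D s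

/-- `D'` is derivable from `D` by a (possibly empty) finite sequence of pebbling moves. -/
def Derivable {V : Type*} (G : SimpleGraph V) (D D' : V → ℕ) : Prop :=
  Relation.ReflTransGen (PebblingMove G) D D'

/-- `D` covers `W` if some distribution derivable from `D` contains `W`. -/
def Covers {V : Type*} (G : SimpleGraph V) (D W : V → ℕ) : Prop :=
  ∃ D' : V → ℕ, Derivable G D D' ∧ ∀ q : V, W q ≤ D' q

/-- The standard value `V_S(D) = ∑_q D(q) · 2^{d(q,S)}`, where
`d(q,S) = min_{r ∈ S} d(q,r)`. -/
noncomputable def stdVal {V : Type*} [Fintype V] (G : SimpleGraph V) (S : Set V)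
    (D : V → ℕ) : ℕ :=
  ∑ q : V, D q * 2 ^ sInf {d : ℕ | ∃ r ∈ S, G.dist q r = d}

/-- The stacking number `SN_W(G) = max_v ∑_u W(u) · 2^{d(u,v)}`. -/
noncomputable def SN {V : Type*} [Fintype V] (G : SimpleGraph V) (W : V → ℕ) : ℕ :=
  Finset.univ.sup fun v : V => ∑ u : V, W u * 2 ^ G.dist u v

/-- The effect of moving two pebbles off `p` and one onto `q` on a weighted pebble count. -/
theorem sum_mul_add_of_move {V : Type*} [Fintype V] {D D' : V → ℕ} {p q : V} (hpq : p ≠ q)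
    (hp : 2 ≤ D p) (hp' : D' p = D p - 2) (hq' : D' q = D q + 1)
    (hs : ∀ s : V, s ≠ p → s ≠ q → D' s = D s) (g : V → ℕ) :
    ∑ s, D' s * g s + 2 * g p = ∑ s, D s * g s + g q := by
  classical
  have h : ∀ s, D' s * g s + (if s = p then 2 * g s else 0)
      = D s * g s + (if s = q then g s else 0) := by
    intro s
    by_cases h1 : s = p
    · subst h1
      obtain ⟨k, hk⟩ := Nat.exists_eq_add_of_le hp
      have : D' s = k := by omega
      simp [hpq, hk, this]
      ring
    · by_cases h2 : s = q
      · subst h2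
        simp [h1, hq']
        ring
      · simp [h1, h2, hs s h1 h2]
  have := Finset.sum_congr (rfl : (Finset.univ : Finset V) = Finset.univ) fun s _ => h s
  simpa [Finset.sum_add_distrib] using this

/-- The pebble count weighted by `2 ^ G.dist · v` does not increase under pebbling moves. -/
theorem Derivable.sum_mul_two_pow_dist_le {V : Type*} [Fintype V] {G : SimpleGraph V}
    (hG : G.Connected) (v : V) {D D' : V → ℕ} (h : Derivable G D D') :
    ∑ s, D' s * 2 ^ G.dist s v ≤ ∑ s, D s * 2 ^ G.dist s v := by
  induction h with
  | refl => rfl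
  | tail _ hm ih =>
    obtain ⟨p, q, hadj, hp, hp', hq', hs⟩ := hm
    have key := sum_mul_add_of_move hadj.ne hp hp' hq' hs fun s => 2 ^ G.dist s v
    have hd : G.dist q v ≤ G.dist p v + 1 := by
      have := hG.dist_triangle (u := q) (v := p) (w := v)
      have h1 := SimpleGraph.dist_eq_one_iff_adj.mpr hadj.symm
      omega
    have hle : 2 ^ G.dist q v ≤ 2 * 2 ^ G.dist p v := by
      rw [← pow_succ']
      exact Nat.pow_le_pow_right two_pos hd
    omega

theorem SimpleGraph.Connected.exists_adj_dist_eq {V : Type*} {G : SimpleGraph V}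
    (hG : G.Connected) {x t : V} (hne : x ≠ t) :
    ∃ y, G.Adj x y ∧ G.dist x t = G.dist y t + 1 := by
  obtain ⟨p, hp⟩ := hG.exists_walk_length_eq_dist x t
  cases p with
  | nil => exact absurd rfl hne
  | @cons _ y _ hadj p =>
    refine ⟨y, hadj, ?_⟩
    have h1 := SimpleGraph.dist_le p
    have h2 := hG.dist_triangle (u := x) (v := y) (w := t)
    have h3 := SimpleGraph.dist_eq_one_iff_adj.mpr hadj
    rw [SimpleGraph.Walk.length_cons] at hp
    omega

/-- If every vertex strictly between `x` and `t` on a geodesic is occupied, then two pebbles on `x`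
suffice to push one pebble to `t` using one pebble from each interior vertex of a geodesic; this
preserves any weighted pebble count whose weight doubles at each step from `x` towards `t`. -/
theorem exists_derivable_along_geodesic {V : Type*} [Fintype V] {G : SimpleGraph V}
    (hG : G.Connected) (g : V → ℕ) (t : V) (n : ℕ) :
    ∀ (x : V) (D : V → ℕ), G.dist x t = n → x ≠ t → 2 ≤ D x →
      (∀ q, G.dist x q + G.dist q t = n → q ≠ x → q ≠ t → 1 ≤ D q) →
      (∀ q, G.dist x q + G.dist q t = n → g q = 2 ^ G.dist x q * g x) →
      ∃ D', Derivable G D D' ∧ ∑ s, D' s * g s = ∑ s, D s * g s ∧ ∑ s, D' s < ∑ s, D s ∧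
        D' x + 1 ≤ D x ∧ D' t ≤ D t + 1 ∧ ∀ s, s ≠ t → D' s ≤ D s := by
  classical
  induction n with
  | zero => exact fun x D hd hne => absurd (hG.dist_eq_zero_iff.mp hd) hne
  | succ n ih =>
    intro x D hd hne hx hint hg
    obtain ⟨y, hadj, hy⟩ := hG.exists_adj_dist_eq hne
    have hxy : G.dist x y = 1 := SimpleGraph.dist_eq_one_iff_adj.mpr hadj
    have hgy : g y = 2 * g x := by simpa [hxy] using hg y (by omega)
    obtain ⟨D₁, h1x, h1y, h1s⟩ : ∃ D₁ : V → ℕ, D₁ x = D x - 2 ∧ D₁ y = D y + 1 ∧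
        ∀ s, s ≠ x → s ≠ y → D₁ s = D s :=
      ⟨fun s => if s = x then D x - 2 else if s = y then D y + 1 else D s,
        by simp, by simp [hadj.ne'], fun s h1 h2 => by simp [h1, h2]⟩
    have hmove : PebblingMove G D D₁ := ⟨x, y, hadj, hx, h1x, h1y, h1s⟩
    have hsum := sum_mul_add_of_move hadj.ne hx h1x h1y h1s g
    have hcard := sum_mul_add_of_move hadj.ne hx h1x h1y h1s fun _ => 1
    simp only [mul_one] at hcard
    by_cases hyt : y = t
    · subst hyt
      refine ⟨D₁, .single hmove, by omega, by omega, by omega, by omega, fun s hs => ?_⟩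
      by_cases hsx : s = x
      · subst hsx; omega
      · exact (h1s s hsx hs).le
    · have hstep : ∀ q, G.dist y q + G.dist q t = n → G.dist x q = G.dist y q + 1 := by
        intro q hq
        have h2 := hG.dist_triangle (u := x) (v := y) (w := q)
        have h3 := hG.dist_triangle (u := x) (v := q) (w := t)
        omega
      have hDy : 1 ≤ D y := hint y (by omega) hadj.ne' hyt
      obtain ⟨D', hder, hs', hc', hy', ht', hle⟩ := ih y D₁ (by omega) hyt (by omega)
        (fun q hq hqy hqt => by
          have hxq := hstep q hq
          have hqx : q ≠ x := by
            rintro rfl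
            simp at hxq
          rw [h1s q hqx hqy]
          exact hint q (by omega) hqx hqt)
        (fun q hq => by
          have hxq := hstep q hq
          rw [hg q (by omega), hxq, hgy]
          ring)
      have htD : D₁ t = D t := h1s t hne.symm (Ne.symm hyt)
      have hxD := hle x hne
      refine ⟨D', .head hmove hder, by omega, by omega, by omega, by omega, fun s hs => ?_⟩
      by_cases hsx : s = x
      · subst hsx; omega
      · by_cases hsy : s = y
        · subst hsy; omega
        · exact (hle s hs).trans (h1s s hsx hsy).le

theorem sInf_dist_le {V : Type*} (G : SimpleGraph V) {S : Set V} (q : V) {r : V} (hr : r ∈ S) :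
    sInf {d : ℕ | ∃ r ∈ S, G.dist q r = d} ≤ G.dist q r :=
  Nat.sInf_le ⟨r, hr, rfl⟩

theorem exists_dist_eq_sInf {V : Type*} (G : SimpleGraph V) {S : Set V} (hS : S.Nonempty) (q : V) :
    ∃ r ∈ S, G.dist q r = sInf {d : ℕ | ∃ r ∈ S, G.dist q r = d} :=
  let ⟨r, hr⟩ := hS
  Nat.sInf_mem (s := {d : ℕ | ∃ r ∈ S, G.dist q r = d}) ⟨_, r, hr, rfl⟩

theorem stdVal_anti {V : Type*} [Fintype V] (G : SimpleGraph V) {S T : Set V} (hS : S.Nonempty)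
    (hST : S ⊆ T) (D : V → ℕ) : stdVal G T D ≤ stdVal G S D := by
  refine Finset.sum_le_sum fun q _ => Nat.mul_le_mul_left _ (Nat.pow_le_pow_right two_pos ?_)
  obtain ⟨r, hr, h⟩ := exists_dist_eq_sInf G hS q
  exact h ▸ sInf_dist_le G q (hST hr)

theorem stdVal_le_SN {V : Type*} [Fintype V] (G : SimpleGraph V) {S : Set V} (hS : S.Nonempty)
    (W : V → ℕ) : stdVal G S W ≤ SN G W := by
  obtain ⟨v, hv⟩ := hS
  calc stdVal G S W ≤ ∑ u, W u * 2 ^ G.dist u v :=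
        Finset.sum_le_sum fun q _ =>
          Nat.mul_le_mul_left _ (Nat.pow_le_pow_right two_pos (sInf_dist_le G q hv))
    _ ≤ SN G W := Finset.le_sup (f := fun v : V => ∑ u : V, W u * 2 ^ G.dist u v)
        (Finset.mem_univ v)

/-- If some vertex is overfull and some vertex is deficient, pebbling moves can decrease the total
number of pebbles without creating new overfull vertices and without changing the standard value
relative to the set of overfull vertices. -/
theorem exists_derivable_stdVal_eq {V : Type*} [Fintype V] {G : SimpleGraph V}
    (hG : G.Connected) {W : V → ℕ} (hW : ∀ q, 0 < W q) {D : V → ℕ}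
    (hF : {q | W q < D q}.Nonempty) (hT : {q | D q < W q}.Nonempty) :
    ∃ D', Derivable G D D' ∧ ∑ s, D' s < ∑ s, D s ∧ {q | W q < D' q} ⊆ {q | W q < D q} ∧
      stdVal G {q | W q < D q} D' = stdVal G {q | W q < D q} D := by
  obtain ⟨⟨f, t⟩, ⟨hf, ht⟩, hmin⟩ := Set.exists_min_image
    ({q | W q < D q} ×ˢ {q | D q < W q}) (fun z => G.dist z.1 z.2) (Set.toFinite _) (hF.prod hT)
  simp only [Set.mem_ofPred_eq] at hf ht
  replace hmin : ∀ a b, W a < D a → D b < W b → G.dist f t ≤ G.dist a b :=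
    fun a b ha hb => hmin (a, b) ⟨ha, hb⟩
  have hft : f ≠ t := by
    rintro rfl
    omega
  have hδ : ∀ q, G.dist f q + G.dist q t = G.dist f t →
      sInf {d : ℕ | ∃ r ∈ {q | W q < D q}, G.dist q r = d} = G.dist f q := by
    intro q hq
    obtain ⟨r, hr, h⟩ := exists_dist_eq_sInf G hF q
    have h1 := sInf_dist_le G (S := {q | W q < D q}) q hf
    have h2 := hmin r t hr ht
    have h3 := hG.dist_triangle (u := r) (v := q) (w := t)
    rw [G.dist_comm] at h h1
    rw [G.dist_comm] at h1
    rw [G.dist_comm (u := q) (v := f)] at h1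
    omega
  obtain ⟨D', hder, hval, hlt, -, ht', hle⟩ := exists_derivable_along_geodesic hG
    (fun q => 2 ^ sInf {d : ℕ | ∃ r ∈ {q | W q < D q}, G.dist q r = d}) t _ f D rfl hft
    (by have := hW f; omega)
    (fun q hq _ hqt => by
      have h1 : 0 < G.dist q t := hG.pos_dist_of_ne hqt
      have h2 := hW q
      by_contra h
      have := hmin f q hf (by omega)
      omega)
    (fun q hq => by
      have h0 := hδ f (by simp)
      simp only [hδ q hq, h0]
      simp)
  refine ⟨D', hder, hlt, fun q hq => ?_, hval⟩
  simp only [Set.mem_ofPred_eq] at hq ⊢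
  by_cases hqt : q = t
  · subst hqt; omega
  · exact hq.trans_le (hle q hqt)

theorem covers_of_SN_le_stdVal {V : Type*} [Fintype V] {G : SimpleGraph V}
    (hG : G.Connected) {W : V → ℕ} (hW : ∀ q, 0 < W q) (D : V → ℕ) {S : Set V}
    (hS : S.Nonempty) (hFS : {q | W q < D q} ⊆ S) (hval : SN G W ≤ stdVal G S D) :
    Covers G D W := by
  induction hn : ∑ s, D s using Nat.strong_induction_on generalizing D S with
  | _ n ih =>
  by_cases hT : {q | D q < W q}.Nonempty
  · by_cases hF : {q | W q < D q}.Nonempty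
    · obtain ⟨D', hder, hlt, hsub, heq⟩ := exists_derivable_stdVal_eq hG hW hF hT
      obtain ⟨E, hE, hWE⟩ := ih _ (hn ▸ hlt) D' hF hsub
        (heq ▸ hval.trans (stdVal_anti G hF hFS D)) rfl
      exact ⟨E, Relation.ReflTransGen.trans hder hE, hWE⟩
    · obtain ⟨t, ht⟩ := hT
      have hle : ∀ q, D q ≤ W q := fun q => not_lt.mp fun h => hF ⟨q, h⟩
      have : stdVal G S D < stdVal G S W :=
        Finset.sum_lt_sum (fun q _ => Nat.mul_le_mul_right _ (hle q))
          ⟨t, Finset.mem_univ t, Nat.mul_lt_mul_of_pos_right ht (by positivity)⟩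
      have := stdVal_le_SN G hS W
      omega
  · exact ⟨D, .refl, fun q => not_lt.mp fun h => hT ⟨q, h⟩⟩

/-- Stacking theorem: Φ_W(G) = SN_W(G), i.e. SN_W(G) is the least m such that
every distribution with exactly m pebbles in total covers W. -/
theorem stacking_theorem {V : Type*} [Fintype V] (G : SimpleGraph V)
    (hG : G.Connected) (W : V → ℕ) (hW : ∀ q : V, 0 < W q) :
    IsLeast {m : ℕ | ∀ D : V → ℕ, (∑ q : V, D q) = m → Covers G D W} (SN G W) := by
  classical
  constructor
  · intro D hD
    have := hG.nonempty
    refine covers_of_SN_le_stdVal hG hW D Set.univ_nonempty (Set.subset_univ _) ?_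
    rw [← hD]
    exact Finset.sum_le_sum fun q _ => Nat.le_mul_of_pos_right _ (by positivity)
  · intro m hm
    refine Finset.sup_le fun v _ => ?_
    obtain ⟨D', hder, hWD⟩ := hm (Pi.single v m) (by simp)
    calc ∑ u, W u * 2 ^ G.dist u v ≤ ∑ u, D' u * 2 ^ G.dist u v :=
          Finset.sum_le_sum fun u _ => Nat.mul_le_mul_right _ (hWD u)
      _ ≤ ∑ u, (Pi.single v m : V → ℕ) u * 2 ^ G.dist u v := hder.sum_mul_two_pow_dist_le hG v
      _ = m := by simp [Pi.single_apply]
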